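/- Let G be a group and ω : G × G → 𝕋 a 2-cocycle, i.e., ω(g₁, g₂g₃) · ω(g₂, g₃) = ω(g₁g₂, g₃) · ω(g₁, g₂) for all g₁, g₂, g₃ ∈ G. Let ω̃ denote the group homomorphism from the free abelian group on G × G to 𝕋 induced by ω, and let ∂₂ denote the group homomorphism from the free abelian group on G × G to the free abelian group on G sending the generator (g₁, g₂) to (g₁) − (g₁g₂) + (g₂). If ω̃ vanishes on the kernel of ∂₂ (that is, ω̃(z) = 1 for every 2-cycle z), then ω is a 2-coboundary: there exists a function γ : G → 𝕋 such that ω(g, h) = γ(g) · γ(h) · γ(gh)⁻¹ for all g, h ∈ G. -/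

import Mathlib

/-- The boundary map `∂₂` of the bar resolution: from the free abelian group on
`G × G` to the free abelian group on `G`, sending `(g₁, g₂)` to
`(g₁) - (g₁g₂) + (g₂)`. -/
def barBoundary2 (G : Type*) [Group G] :
    FreeAbelianGroup (G × G) →+ FreeAbelianGroup G :=
  FreeAbelianGroup.lift fun p =>
    FreeAbelianGroup.of p.1 - FreeAbelianGroup.of (p.1 * p.2) + FreeAbelianGroup.of p.2

/-- Integer multiplication by `n ≠ 0` is surjective on the circle group, written additively. -/
theorem Circle.additive_zsmul_surjective {n : ℤ} (hn : n ≠ 0) :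
    Function.Surjective (fun a : Additive Circle => n • a) := by
  intro a
  have hn' : (n : ℝ) ≠ 0 := Int.cast_ne_zero.mpr hn
  let t : ℝ := Complex.arg (a.toMul : ℂ)
  refine ⟨Circle.expHom (t / n), ?_⟩
  change n • Circle.expHom (t / n) = a
  rw [← map_zsmul, zsmul_eq_mul, mul_div_cancel₀ _ hn']
  exact congrArg Additive.ofMul (Circle.exp_arg a.toMul)

/-- The circle group, written additively, satisfies Baer's criterion over `ℤ`. -/
theorem Circle.baer_additive : Module.Baer ℤ (Additive Circle) :=
  letI : DivisibleBy (Additive Circle) ℤ :=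
    divisibleByOfSMulRightSurj _ _ fun hn => Circle.additive_zsmul_surjective hn
  Module.Baer.of_divisible _

/-- A homomorphism into a group satisfying Baer's criterion over `ℤ` which vanishes on the kernel
of `d` factors through `d`. -/
theorem Module.Baer.exists_comp_eq_of_ker_le {A B Q : Type*} [AddCommGroup A] [AddCommGroup B]
    [AddCommGroup Q] (hQ : Module.Baer ℤ Q) (d : A →+ B) (f : A →+ Q) (h : d.ker ≤ f.ker) :
    ∃ φ : B →+ Q, φ.comp d = f := by
  obtain ⟨φ, hφ⟩ := hQ.extension_property_addMonoidHom (QuotientAddGroup.kerLift d)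
    (QuotientAddGroup.kerLift_injective d) (QuotientAddGroup.lift d.ker f h)
  exact ⟨φ, AddMonoidHom.ext fun a => DFunLike.congr_fun hφ (a : A ⧸ d.ker)⟩

/-- If a `𝕋`-valued 2-cocycle `ω` on a group `G` vanishes (i.e. the induced
homomorphism on the free abelian group on `G × G` vanishes) on all 2-cycles,
then `ω` is a 2-coboundary. -/
theorem cocycle_is_coboundary_of_vanishes_on_cycles
    (G : Type*) [Group G] (ω : G × G → Circle)
    (hcoc : ∀ g₁ g₂ g₃ : G,
      ω (g₁, g₂ * g₃) * ω (g₂, g₃) = ω (g₁ * g₂, g₃) * ω (g₁, g₂))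
    (hvanish : ∀ z ∈ (barBoundary2 G).ker,
      FreeAbelianGroup.lift (fun p => Additive.ofMul (ω p)) z = 0) :
    ∃ γ : G → Circle, ∀ g h : G, ω (g, h) = γ g * γ h * (γ (g * h))⁻¹ := by
  obtain ⟨φ, hφ⟩ := Circle.baer_additive.exists_comp_eq_of_ker_le (barBoundary2 G)
    (FreeAbelianGroup.lift fun p => Additive.ofMul (ω p)) hvanish
  refine ⟨fun g => (φ (FreeAbelianGroup.of g)).toMul, fun g h => ?_⟩
  have key := DFunLike.congr_fun hφ (FreeAbelianGroup.of (g, h))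
  simp only [AddMonoidHom.comp_apply, barBoundary2, FreeAbelianGroup.lift_apply_of, map_add,
    map_sub] at key
  rw [sub_add_eq_add_sub, sub_eq_add_neg] at key
  exact (congrArg Additive.toMul key).symm
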